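/- The rational primes 2 and 3 are inert in the real cubic subfield K of the 13th cyclotomic field, and 13 is totally ramified in K, being the unique ramified prime. -/

import Mathlib

open NumberField

theorem Ideal.eq_of_le_of_absNorm_dvd {S : Type*} [CommRing S] [IsDedekindDomain S]
    [Module.Free ℤ S] [Module.Finite ℤ S] [CharZero S] {I J : Ideal S} (hI : I ≠ ⊥) (hle : I ≤ J)
    (h : Ideal.absNorm I ∣ Ideal.absNorm J) : I = J := by
  obtain ⟨A, rfl⟩ := Ideal.dvd_iff_le.mpr hle
  have hpos : 0 < Ideal.absNorm (J * A) :=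
    Nat.pos_of_ne_zero fun h0 ↦ hI (Ideal.absNorm_eq_zero_iff.mp h0)
  have hA : Ideal.absNorm A = 1 := by
    rw [map_mul] at h hpos
    exact Nat.dvd_one.mp (Nat.dvd_of_mul_dvd_mul_left (Nat.pos_of_mul_pos_right hpos)
      (by simpa using h))
  rw [Ideal.absNorm_eq_one_iff.mp hA, Ideal.mul_top]

namespace NumberField

section RelativeDegree

variable {K L : Type*} [Field K] [NumberField K] [Field L] [NumberField L] [Algebra K L]
  [IsGalois K L]

theorem ramificationIdx_mul_inertiaDeg_dvd_finrank (P : Ideal (𝓞 K)) [P.IsPrime]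
    (Q : Ideal (𝓞 L)) [Q.IsPrime] [Q.LiesOver P] :
    Q.ramificationIdx (𝓞 K) * Q.inertiaDeg (𝓞 K) ∣ Module.finrank K L := by
  rw [← IsGalois.card_aut_eq_finrank,
    ← Ideal.ncard_primesOver_mul_ramificationIdxIn_mul_inertiaDegIn P (𝓞 L) Gal(L/K),
    Ideal.ramificationIdxIn_eq_ramificationIdx P Q Gal(L/K),
    Ideal.inertiaDegIn_eq_inertiaDeg P Q Gal(L/K)]
  exact dvd_mul_left _ _

end RelativeDegree

section PrimeBelow

variable {K : Type*} [Field K] [NumberField K] (p : ℕ) [Fact p.Prime]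

theorem absNorm_span_natCast (n : ℕ) :
    Ideal.absNorm (Ideal.span {(n : 𝓞 K)}) = n ^ Module.finrank ℚ K := by
  have := Algebra.norm_algebraMap (R := ℤ) (S := 𝓞 K) (n : ℤ)
  rw [Ideal.absNorm_span_singleton, ← RingOfIntegers.rank K]
  simpa [Int.natAbs_pow] using congrArg Int.natAbs this

omit [NumberField K] in
theorem map_span_natCast (n : ℕ) :
    (Ideal.span {(n : ℤ)}).map (algebraMap ℤ (𝓞 K)) = Ideal.span {(n : 𝓞 K)} := by
  simp [Ideal.map_span]

theorem span_natCast_ne_bot : Ideal.span {(p : 𝓞 K)} ≠ ⊥ := by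
  simp [NeZero.ne p]

theorem span_natCast_isPrime_of_finrank_le_inertiaDeg (P : Ideal (𝓞 K)) [P.IsPrime]
    [P.LiesOver (Ideal.span {(p : ℤ)})] (h : Module.finrank ℚ K ≤ P.inertiaDeg ℤ) :
    (Ideal.span {(p : 𝓞 K)}).IsPrime := by
  rw [Ideal.eq_of_le_of_absNorm_dvd (J := P) (span_natCast_ne_bot p)]
  · infer_instance
  · rw [← map_span_natCast, Ideal.map_le_iff_le_comap]
    exact (P.over_def (Ideal.span {(p : ℤ)})).le
  · rw [absNorm_span_natCast, ← Ideal.pow_inertiaDeg p P]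
    exact pow_dvd_pow p h

theorem ramificationIdx_eq_multiplicity_span (P : Ideal (𝓞 K)) [P.IsPrime]
    [P.LiesOver (Ideal.span {(p : ℤ)})] :
    P.ramificationIdx ℤ = multiplicity P (Ideal.span {(p : 𝓞 K)}) := by
  rw [← map_span_natCast]
  exact Ideal.IsDedekindDomain.ramificationIdx_eq_multiplicity (Ideal.span {(p : ℤ)}) P
    (map_span_natCast (K := K) p ▸ span_natCast_ne_bot p)

theorem span_natCast_eq_pow_of_finrank_le_ramificationIdx (P : Ideal (𝓞 K)) [P.IsPrime]
    [P.LiesOver (Ideal.span {(p : ℤ)})] (h : Module.finrank ℚ K ≤ P.ramificationIdx ℤ) :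
    Ideal.span {(p : 𝓞 K)} = P ^ Module.finrank ℚ K := by
  rw [ramificationIdx_eq_multiplicity_span p P] at h
  refine Ideal.eq_of_le_of_absNorm_dvd (span_natCast_ne_bot p)
    (Ideal.dvd_iff_le.mp (pow_dvd_of_le_multiplicity h)) ?_
  rw [absNorm_span_natCast, map_pow, ← Ideal.pow_inertiaDeg p P]
  exact pow_dvd_pow_of_dvd (dvd_pow_self p (Ideal.inertiaDeg_pos ..).ne') _

omit [NumberField K] in
theorem liesOver_span_natCast_of_span_le (P : Ideal (𝓞 K)) [P.IsPrime]
    (hle : Ideal.span {(p : 𝓞 K)} ≤ P) : P.LiesOver (Ideal.span {(p : ℤ)}) := by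
  rw [Ideal.liesOver_span_iff Ideal.IsPrime.ne_top' (Nat.prime_iff_prime_int.mp Fact.out)]
  simpa using (Ideal.span_singleton_le_iff_mem P).mp hle

theorem le_ramificationIdx_of_span_le_pow (P : Ideal (𝓞 K)) [P.IsPrime]
    [P.LiesOver (Ideal.span {(p : ℤ)})] {n : ℕ} (hle : Ideal.span {(p : 𝓞 K)} ≤ P ^ n) :
    n ≤ P.ramificationIdx ℤ := by
  rw [ramificationIdx_eq_multiplicity_span p P]
  exact (FiniteMultiplicity.of_not_isUnit (Ideal.isUnit_iff.not.mpr Ideal.IsPrime.ne_top')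
    (span_natCast_ne_bot p)).le_multiplicity_of_pow_dvd (Ideal.dvd_iff_le.mpr hle)

end PrimeBelow

end NumberField

theorem cubic_subfield_splitting (K L : Type*) [Field K] [NumberField K] [Field L] [NumberField L]
    [Algebra K L] [IsCyclotomicExtension {13} ℚ L] (hdeg : Module.finrank ℚ K = 3) :
    (Ideal.span {(2 : 𝓞 K)}).IsPrime ∧
    (Ideal.span {(3 : 𝓞 K)}).IsPrime ∧
    (∃ P : Ideal (𝓞 K), P.IsPrime ∧ Ideal.span {(13 : 𝓞 K)} = P ^ 3) ∧
    (∀ p : ℕ, p.Prime →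
      (∃ P : Ideal (𝓞 K), P.IsPrime ∧ Ideal.span {(p : 𝓞 K)} ≤ P ^ 2) → p = 13) := by
  have orderOf_two : orderOf (2 : ZMod 13) = 12 :=
    (orderOf_eq_iff (by norm_num)).mpr ⟨by decide, by decide⟩
  have orderOf_three : orderOf (3 : ZMod 13) = 3 :=
    (orderOf_eq_iff (by norm_num)).mpr ⟨by decide, by decide⟩
  have : IsGalois ℚ L := IsCyclotomicExtension.isGalois {13} ℚ L
  have : IsGalois K L := IsGalois.tower_top_of_isGalois ℚ K L
  have hL : Module.finrank K L = 4 := by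
    have h₁ := Module.finrank_mul_finrank ℚ K L
    have h₂ : Module.finrank ℚ L = 12 := by
      rw [IsCyclotomicExtension.finrank (n := 13) L
        (Polynomial.cyclotomic.irreducible_rat (by norm_num))]
      decide
    rw [hdeg, h₂] at h₁
    omega
  have hp13 : Fact (Nat.Prime 13) := ⟨by norm_num⟩
  have above (p : ℕ) [Fact p.Prime] (P : Ideal (𝓞 K)) [P.IsPrime]
      [P.LiesOver (Ideal.span {(p : ℤ)})] :
      ∃ a b : ℕ, a * b ∣ 4 ∧ ∃ Q : Ideal (𝓞 L), ∃ _ : Q.IsPrime,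
        ∃ _ : Q.LiesOver (Ideal.span {(p : ℤ)}),
        Q.ramificationIdx ℤ = P.ramificationIdx ℤ * a ∧ Q.inertiaDeg ℤ = P.inertiaDeg ℤ * b := by
    obtain ⟨Q, _, _⟩ := P.nonempty_primesOver (S := 𝓞 L)
    exact ⟨_, _, hL ▸ ramificationIdx_mul_inertiaDeg_dvd_finrank P Q, Q, ‹_›, .trans Q P _,
      Ideal.ramificationIdx_tower P Q, Ideal.inertiaDeg_tower P Q⟩
  have inert (p : ℕ) [Fact p.Prime] (h13 : ¬ p ∣ 13) (ho : 3 ∣ orderOf (p : ZMod 13)) :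
      (Ideal.span {(p : 𝓞 K)}).IsPrime := by
    obtain ⟨⟨P, _, _⟩⟩ := (Ideal.span {(p : ℤ)}).nonempty_primesOver (S := 𝓞 K)
    obtain ⟨a, b, hab, Q, _, _, -, hf⟩ := above p P
    rw [IsCyclotomicExtension.Rat.inertiaDeg_eq_of_not_dvd p L Q h13] at hf
    refine span_natCast_isPrime_of_finrank_le_inertiaDeg p P ?_
    have hb : Nat.Coprime 3 b := Nat.Coprime.coprime_dvd_right
      ((dvd_mul_left b a).trans hab) (by norm_num)
    rw [hdeg]
    exact Nat.le_of_dvd (Ideal.inertiaDeg_pos ..) (hb.dvd_of_dvd_mul_right (hf ▸ ho))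
  refine ⟨?_, ?_, ?_, ?_⟩
  · refine mod_cast inert 2 (by norm_num) ?_
    rw [Nat.cast_ofNat, orderOf_two]
    norm_num
  · refine mod_cast inert 3 (by norm_num) ?_
    rw [Nat.cast_ofNat, orderOf_three]
  · obtain ⟨⟨P, _, _⟩⟩ := (Ideal.span {((13 : ℕ) : ℤ)}).nonempty_primesOver (S := 𝓞 K)
    obtain ⟨a, b, hab, Q, _, _, he, -⟩ := above 13 P
    rw [IsCyclotomicExtension.Rat.ramificationIdx_eq_of_prime 13 L Q] at he
    have ha : Nat.Coprime 3 a := Nat.Coprime.coprime_dvd_right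
      ((dvd_mul_right a b).trans hab) (by norm_num)
    refine ⟨P, ‹_›, ?_⟩
    rw [← hdeg]
    refine mod_cast span_natCast_eq_pow_of_finrank_le_ramificationIdx 13 P ?_
    rw [hdeg]
    exact Nat.le_of_dvd (Ideal.ramificationIdx_pos ..)
      (ha.dvd_of_dvd_mul_right (he ▸ by norm_num))
  · rintro p hp ⟨P, _, hle⟩
    by_contra hne
    have : Fact p.Prime := ⟨hp⟩
    have := liesOver_span_natCast_of_span_le p P (hle.trans (Ideal.pow_le_self two_ne_zero))
    have h2 := le_ramificationIdx_of_span_le_pow p P hle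
    obtain ⟨a, b, -, Q, _, _, he, -⟩ := above p P
    rw [IsCyclotomicExtension.Rat.ramificationIdx_eq_of_not_dvd (m := 13) p L Q
      (fun h ↦ hne ((Nat.prime_dvd_prime_iff_eq hp hp13.out).mp h))] at he
    have := Nat.eq_one_of_mul_eq_one_right he.symm
    omega

theorem stmt8 (K : Type*) [Field K] [NumberField K]
    (f : K →+* CyclotomicField 13 ℚ) (hdeg : Module.finrank ℚ K = 3) :
    (Ideal.span {(2 : 𝓞 K)}).IsPrime ∧
    (Ideal.span {(3 : 𝓞 K)}).IsPrime ∧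
    (∃ P : Ideal (𝓞 K), P.IsPrime ∧ Ideal.span {(13 : 𝓞 K)} = P ^ 3) ∧
    (∀ p : ℕ, p.Prime →
      (∃ P : Ideal (𝓞 K), P.IsPrime ∧ Ideal.span {(p : 𝓞 K)} ≤ P ^ 2) → p = 13) :=
  let _ : Algebra K (CyclotomicField 13 ℚ) := f.toAlgebra
  have : IsCyclotomicExtension {13} ℚ (CyclotomicField 13 ℚ) := by
    convert! CyclotomicField.isCyclotomicExtension 13 ℚ
  cubic_subfield_splitting K (CyclotomicField 13 ℚ) hdeg
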